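/- Let X = MD(G, S0, S1, T0, T1) be a strongly connected mixed Cayley digraph with λ(X) < δ(X), and let A be a λ-atom of X with A ∩ X_i = H_i × {i}, H_i ⊆ G for i = 0,1. If (1_G, 0) ∈ A, then there exists t ∈ T0 with H_1 = t·H_0 (as subsets of G); moreover there exist g_1, …, g_k ∈ G such that G is the disjoint union of the right cosets H_0·g_j, X_0 = ∪_j (H_0·g_j) × {0}, and X_1 = ∪_j (t·H_0·g_j) × {1}. -/

import Mathlib

open Set Pointwise

/-- Arc relation of the mixed Cayley digraph `MD(G,S0,S1,T0,T1)` on vertex set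
`G × Bool`, where `false` plays the role of the index `0` and `true` of `1`. -/
def MDArc {G : Type*} [Group G] (S0 S1 T0 T1 : Set G) (u v : G × Bool) : Prop :=
  (u.2 = false ∧ v.2 = false ∧ ∃ s ∈ S0, v.1 = s * u.1) ∨
  (u.2 = true ∧ v.2 = true ∧ ∃ s ∈ S1, v.1 = s * u.1) ∨
  (u.2 = false ∧ v.2 = true ∧ ∃ t ∈ T0, v.1 = t * u.1) ∨
  (u.2 = true ∧ v.2 = false ∧ ∃ t ∈ T1, u.1 = t * v.1)

/-- A digraph (given by its arc relation) is strongly connected if every vertex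
is reachable from every other vertex by a directed path. -/
def DigraphStronglyConnected {V : Type*} (R : V → V → Prop) : Prop :=
  ∀ u v : V, Relation.ReflTransGen R u v

/-- Out-degree of a vertex: the number of arcs originating at it. -/
noncomputable def outDegree {V : Type*} (R : V → V → Prop) (v : V) : ℕ :=
  {w | R v w}.ncard

/-- In-degree of a vertex: the number of arcs terminating at it. -/
noncomputable def inDegree {V : Type*} (R : V → V → Prop) (v : V) : ℕ :=
  {w | R w v}.ncard

/-- `δ`: the minimum, over all vertices, of in-degrees and out-degrees. -/
noncomputable def minDegree {V : Type*} (R : V → V → Prop) : ℕ :=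
  sInf {n | ∃ v, n = outDegree R v ∨ n = inDegree R v}

/-- `W` is an arc-disconnecting set: a set of arcs whose deletion leaves a
digraph that is not strongly connected. -/
def IsDisconnectingArcSet {V : Type*} (R : V → V → Prop) (W : Set (V × V)) : Prop :=
  (∀ p ∈ W, R p.1 p.2) ∧
  ¬ DigraphStronglyConnected (fun u v => R u v ∧ (u, v) ∉ W)

/-- The arc connectivity `λ`: the minimum cardinality of an arc-disconnecting set. -/
noncomputable def arcConnectivity {V : Type*} (R : V → V → Prop) : ℕ :=
  sInf {n | ∃ W : Set (V × V), IsDisconnectingArcSet R W ∧ W.ncard = n}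

/-- `ω⁺(A)`: the set of arcs from `A` to its complement. -/
def omegaPlus {V : Type*} (R : V → V → Prop) (A : Set V) : Set (V × V) :=
  {p | R p.1 p.2 ∧ p.1 ∈ A ∧ p.2 ∉ A}

/-- `ω⁻(A)`: the set of arcs from the complement of `A` to `A`. -/
def omegaMinus {V : Type*} (R : V → V → Prop) (A : Set V) : Set (V × V) :=
  {p | R p.1 p.2 ∧ p.1 ∉ A ∧ p.2 ∈ A}

/-- A positive arc fragment: a proper nonempty vertex subset with `|ω⁺(A)| = λ`. -/
def IsPosFragment {V : Type*} (R : V → V → Prop) (A : Set V) : Prop :=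
  A.Nonempty ∧ A ≠ Set.univ ∧ (omegaPlus R A).ncard = arcConnectivity R

/-- A negative arc fragment: a proper nonempty vertex subset with `|ω⁻(A)| = λ`. -/
def IsNegFragment {V : Type*} (R : V → V → Prop) (A : Set V) : Prop :=
  A.Nonempty ∧ A ≠ Set.univ ∧ (omegaMinus R A).ncard = arcConnectivity R

/-- An arc fragment: a positive or negative arc fragment. -/
def IsArcFragment {V : Type*} (R : V → V → Prop) (A : Set V) : Prop :=
  IsPosFragment R A ∨ IsNegFragment R A

/-- A `λ`-atom: an arc fragment of least possible cardinality. -/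
def IsLambdaAtom {V : Type*} (R : V → V → Prop) (A : Set V) : Prop :=
  IsArcFragment R A ∧ ∀ B, IsArcFragment R B → A.ncard ≤ B.ncard

/-- A positive `λ`-atom: a positive arc fragment of least possible cardinality
among all arc fragments. -/
def IsPosLambdaAtom {V : Type*} (R : V → V → Prop) (A : Set V) : Prop :=
  IsPosFragment R A ∧ ∀ B, IsArcFragment R B → A.ncard ≤ B.ncard

/-- A negative `λ`-atom: a negative arc fragment of least possible cardinality
among all arc fragments. -/
def IsNegLambdaAtom {V : Type*} (R : V → V → Prop) (A : Set V) : Prop :=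
  IsNegFragment R A ∧ ∀ B, IsArcFragment R B → A.ncard ≤ B.ncard

/-- A `λ`-superatom: an arc fragment with at least two vertices, of least
possible cardinality among arc fragments with at least two vertices. -/
def IsLambdaSuperatom {V : Type*} (R : V → V → Prop) (A : Set V) : Prop :=
  IsArcFragment R A ∧ 2 ≤ A.ncard ∧
    ∀ B, IsArcFragment R B → 2 ≤ B.ncard → A.ncard ≤ B.ncard

/-- A positive `λ`-superatom. -/
def IsPosLambdaSuperatom {V : Type*} (R : V → V → Prop) (A : Set V) : Prop :=
  IsPosFragment R A ∧ 2 ≤ A.ncard ∧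
    ∀ B, IsArcFragment R B → 2 ≤ B.ncard → A.ncard ≤ B.ncard

/-- A negative `λ`-superatom. -/
def IsNegLambdaSuperatom {V : Type*} (R : V → V → Prop) (A : Set V) : Prop :=
  IsNegFragment R A ∧ 2 ≤ A.ncard ∧
    ∀ B, IsArcFragment R B → 2 ≤ B.ncard → A.ncard ≤ B.ncard

/-- The set of out-arcs of a vertex. -/
def outArcsOf {V : Type*} (R : V → V → Prop) (v : V) : Set (V × V) :=
  {p | R p.1 p.2 ∧ p.1 = v}

/-- The set of in-arcs of a vertex. -/
def inArcsOf {V : Type*} (R : V → V → Prop) (v : V) : Set (V × V) :=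
  {p | R p.1 p.2 ∧ p.2 = v}

/-- A digraph is super-`λ` if every minimum arc-disconnecting set is the set of
in-arcs of some vertex or the set of out-arcs of some vertex. -/
def SuperLambda {V : Type*} (R : V → V → Prop) : Prop :=
  ∀ W : Set (V × V), IsDisconnectingArcSet R W → W.ncard = arcConnectivity R →
    (∃ v, W = outArcsOf R v) ∨ (∃ v, W = inArcsOf R v)

section DigraphCuts

variable {V : Type*} {R : V → V → Prop}

theorem omegaMinus_eq_omegaPlus_compl (A : Set V) : omegaMinus R A = omegaPlus R Aᶜ := by
  ext p; simp [omegaMinus, omegaPlus]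

theorem isDisconnectingArcSet_omegaPlus {A : Set V} (hne : A.Nonempty) (huniv : A ≠ univ) :
    IsDisconnectingArcSet R (omegaPlus R A) := by
  refine ⟨fun p hp => hp.1, fun hsc => ?_⟩
  obtain ⟨u, hu⟩ := hne
  obtain ⟨v, hv⟩ := (ne_univ_iff_exists_notMem A).1 huniv
  refine hv ?_
  induction hsc u v with
  | refl => exact hu
  | @tail b c _ hbc ih =>
    by_contra hc
    exact hbc.2 ⟨hbc.1, by_contra fun hb => hb (ih hb), hc⟩

theorem arcConnectivity_le_ncard_omegaPlus {A : Set V} (hne : A.Nonempty) (huniv : A ≠ univ) :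
    arcConnectivity R ≤ (omegaPlus R A).ncard :=
  Nat.sInf_le ⟨_, isDisconnectingArcSet_omegaPlus hne huniv, rfl⟩

theorem arcConnectivity_le_ncard_omegaMinus {A : Set V} (hne : A.Nonempty) (huniv : A ≠ univ) :
    arcConnectivity R ≤ (omegaMinus R A).ncard := by
  rw [omegaMinus_eq_omegaPlus_compl]
  exact arcConnectivity_le_ncard_omegaPlus (nonempty_compl.2 huniv)
    fun h => hne.ne_empty (compl_univ_iff.1 h)

theorem IsArcFragment.nonempty {A : Set V} (h : IsArcFragment R A) : A.Nonempty :=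
  h.elim (·.1) (·.1)

theorem IsArcFragment.ne_univ {A : Set V} (h : IsArcFragment R A) : A ≠ univ :=
  h.elim (·.2.1) (·.2.1)

theorem IsArcFragment.compl {A : Set V} (h : IsArcFragment R A) : IsArcFragment R Aᶜ := by
  have hne : Aᶜ.Nonempty := nonempty_compl.2 h.ne_univ
  have huniv : Aᶜ ≠ univ := fun h' => h.nonempty.ne_empty (compl_univ_iff.1 h')
  rcases h with h | h
  · refine Or.inr ⟨hne, huniv, ?_⟩
    rw [omegaMinus_eq_omegaPlus_compl, compl_compl, h.2.2]
  · refine Or.inl ⟨hne, huniv, ?_⟩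
    rw [← omegaMinus_eq_omegaPlus_compl, h.2.2]

theorem isPosFragment_of_ncard_le {A : Set V} (hne : A.Nonempty) (huniv : A ≠ univ)
    (h : (omegaPlus R A).ncard ≤ arcConnectivity R) : IsPosFragment R A :=
  ⟨hne, huniv, h.antisymm (arcConnectivity_le_ncard_omegaPlus hne huniv)⟩

theorem isNegFragment_of_ncard_le {A : Set V} (hne : A.Nonempty) (huniv : A ≠ univ)
    (h : (omegaMinus R A).ncard ≤ arcConnectivity R) : IsNegFragment R A :=
  ⟨hne, huniv, h.antisymm (arcConnectivity_le_ncard_omegaMinus hne huniv)⟩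

theorem omegaPlus_image (e : V ≃ V) (he : ∀ u v, R (e u) (e v) ↔ R u v) (A : Set V) :
    omegaPlus R (e '' A) = (e.prodCongr e) '' omegaPlus R A := by
  ext p
  obtain ⟨⟨u, v⟩, rfl⟩ := (e.prodCongr e).surjective p
  simp [omegaPlus, he]

theorem omegaMinus_image (e : V ≃ V) (he : ∀ u v, R (e u) (e v) ↔ R u v) (A : Set V) :
    omegaMinus R (e '' A) = (e.prodCongr e) '' omegaMinus R A := by
  rw [omegaMinus_eq_omegaPlus_compl, omegaMinus_eq_omegaPlus_compl,
    ← image_compl_eq e.bijective, omegaPlus_image e he]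

variable [Finite V]

theorem ncard_omegaPlus_inter_add_union_le (A B : Set V) :
    (omegaPlus R (A ∩ B)).ncard + (omegaPlus R (A ∪ B)).ncard ≤
      (omegaPlus R A).ncard + (omegaPlus R B).ncard := by
  rw [← ncard_inter_add_ncard_union (omegaPlus R (A ∩ B)),
    ← ncard_inter_add_ncard_union (omegaPlus R A)]
  refine add_le_add (ncard_le_ncard ?_) (ncard_le_ncard ?_)
  · rintro p hp
    simp only [omegaPlus, mem_inter_iff, mem_union, mem_ofPred_eq] at hp ⊢
    tauto
  · rintro p hp
    simp only [omegaPlus, mem_inter_iff, mem_union, mem_ofPred_eq] at hp ⊢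
    tauto

theorem ncard_omegaMinus_inter_add_union_le (A B : Set V) :
    (omegaMinus R (A ∩ B)).ncard + (omegaMinus R (A ∪ B)).ncard ≤
      (omegaMinus R A).ncard + (omegaMinus R B).ncard := by
  simp only [omegaMinus_eq_omegaPlus_compl, compl_inter, compl_union]
  rw [add_comm]
  exact ncard_omegaPlus_inter_add_union_le _ _

/-- Two minimum-size minimizers of a submodular function that intersect are equal, provided
they cover at most half of the ground set. -/
theorem eq_of_submodular_minimizers {f : Set V → ℕ} {c : ℕ} {A B : Set V}
    (hsub : f (A ∩ B) + f (A ∪ B) ≤ f A + f B)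
    (hle : ∀ C : Set V, C.Nonempty → C ≠ univ → c ≤ f C)
    (hmin : ∀ C : Set V, C.Nonempty → C ≠ univ → f C = c → A.ncard ≤ C.ncard)
    (hA : f A = c) (hB : f B = c) (hcard : A.ncard = B.ncard)
    (hhalf : A.ncard ≤ Aᶜ.ncard) (hint : (A ∩ B).Nonempty) : A = B := by
  have hunion := ncard_inter_add_ncard_union A B
  have hcompl := ncard_add_ncard_compl A
  have hpos : 0 < (A ∩ B).ncard := (ncard_pos).2 hint
  have hproper : A ∪ B ≠ univ := by
    intro h
    rw [h, ncard_univ] at hunion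
    omega
  have hproper' : A ∩ B ≠ univ := fun h =>
    hproper (univ_subset_iff.1 (h ▸ inter_subset_left.trans subset_union_left))
  have h₁ := hle _ hint hproper'
  have h₂ := hle _ (hint.mono (inter_subset_left.trans subset_union_left)) hproper
  have h₃ := hmin _ hint hproper' (by omega)
  have h₄ : A ∩ B = A := eq_of_subset_of_ncard_le inter_subset_left h₃
  exact eq_of_subset_of_ncard_le (inter_eq_left.1 h₄) hcard.ge

theorem IsLambdaAtom.image_eq_self {A : Set V} (hA : IsLambdaAtom R A) (e : V ≃ V)
    (he : ∀ u v, R (e u) (e v) ↔ R u v) (hint : (A ∩ e '' A).Nonempty) : e '' A = A := by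
  have hcard : A.ncard = (e '' A).ncard := (ncard_image_of_injective A e.injective).symm
  have hhalf : A.ncard ≤ Aᶜ.ncard := hA.2 _ hA.1.compl
  symm
  rcases hA.1 with h | h
  · refine eq_of_submodular_minimizers (f := fun C => (omegaPlus R C).ncard)
      (ncard_omegaPlus_inter_add_union_le _ _)
      (fun C => arcConnectivity_le_ncard_omegaPlus)
      (fun C h₁ h₂ h₃ => hA.2 C (Or.inl ⟨h₁, h₂, h₃⟩)) h.2.2 ?_ hcard hhalf hint
    rw [omegaPlus_image e he, ncard_image_of_injective _ (Equiv.injective _), h.2.2]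
  · refine eq_of_submodular_minimizers (f := fun C => (omegaMinus R C).ncard)
      (ncard_omegaMinus_inter_add_union_le _ _)
      (fun C => arcConnectivity_le_ncard_omegaMinus)
      (fun C h₁ h₂ h₃ => hA.2 C (Or.inr ⟨h₁, h₂, h₃⟩)) h.2.2 ?_ hcard hhalf hint
    rw [omegaMinus_image e he, ncard_image_of_injective _ (Equiv.injective _), h.2.2]

/-- In a loopless digraph, a nonempty set each of whose vertices has an out-neighbour outside
of it sends out at least as many arcs as the smallest out-degree of its vertices. -/
theorem le_ncard_omegaPlus_of_forall_exists_arc (hloop : ∀ v, ¬ R v v) {A : Set V}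
    (hne : A.Nonempty) {d : ℕ} (hd : ∀ v ∈ A, d ≤ outDegree R v)
    (hout : ∀ v ∈ A, ∃ w ∉ A, R v w) : d ≤ (omegaPlus R A).ncard := by
  classical
  have := Fintype.ofFinite V
  have hfiber : ∀ v ∈ A, max 1 (d - (A.ncard - 1)) ≤ ({w | R v w} \ A).ncard := by
    intro v hv
    refine max_le ?_ ?_
    · obtain ⟨w, hw, hvw⟩ := hout v hv
      exact (ncard_pos).2 ⟨w, hvw, hw⟩
    · have hsub : {w | R v w} ⊆ ({w | R v w} \ A) ∪ (A \ {v}) := by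
        intro w hw
        by_cases hwA : w ∈ A
        · refine Or.inr ⟨hwA, ?_⟩
          rintro rfl
          exact hloop _ hw
        · exact Or.inl ⟨hw, hwA⟩
      have h₁ := (ncard_le_ncard hsub).trans (ncard_union_le _ _)
      rw [ncard_sdiff_singleton_of_mem hv] at h₁
      have h₂ := hd v hv
      unfold outDegree at h₂
      omega
  have hsum : A.ncard * max 1 (d - (A.ncard - 1)) ≤ (omegaPlus R A).ncard := by
    rw [ncard_eq_toFinset_card' (omegaPlus R A), Finset.card_eq_sum_card_fiberwise
      (f := Prod.fst) (t := A.toFinset) (fun p hp => by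
        simp only [coe_toFinset] at hp ⊢; exact hp.2.1)]
    nth_rw 1 [ncard_eq_toFinset_card' A]
    rw [← smul_eq_mul]
    refine Finset.card_nsmul_le_sum _ _ _ fun v hv => ?_
    rw [mem_toFinset] at hv
    refine (hfiber v hv).trans ?_
    rw [ncard_eq_toFinset_card']
    refine Finset.card_le_card_of_injOn (fun w => (v, w)) ?_ fun _ _ _ _ h => (Prod.ext_iff.1 h).2
    intro w hw
    simp only [coe_toFinset] at hw
    simp only [Finset.coe_filter, mem_toFinset]
    exact ⟨⟨hw.1, hv, hw.2⟩, rfl⟩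
  refine le_trans ?_ hsum
  have hpos : 0 < A.ncard := (ncard_pos).2 hne
  rcases le_total d A.ncard with h | h
  · exact h.trans (Nat.le_mul_of_pos_right _ (by omega))
  · refine le_trans ?_ (Nat.mul_le_mul_left _ (le_max_right _ _))
    obtain ⟨b, rfl⟩ := Nat.exists_eq_add_of_le h
    rw [show A.ncard + b - (A.ncard - 1) = b + 1 by omega]
    nlinarith

theorem le_ncard_omegaMinus_of_forall_exists_arc (hloop : ∀ v, ¬ R v v) {A : Set V}
    (hne : A.Nonempty) {d : ℕ} (hd : ∀ v ∈ A, d ≤ inDegree R v)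
    (hin : ∀ v ∈ A, ∃ w ∉ A, R w v) : d ≤ (omegaMinus R A).ncard := by
  have hswap : omegaMinus R A = Prod.swap '' omegaPlus (flip R) A := by
    ext p
    simp [omegaMinus, omegaPlus, flip, image_swap_eq_preimage_swap]
    tauto
  rw [hswap, ncard_image_of_injective _ Prod.swap_injective]
  exact le_ncard_omegaPlus_of_forall_exists_arc (R := flip R) hloop hne hd hin

theorem ncard_omegaPlus_le_of_no_arc {A B : Set V} (hBA : B ⊆ A)
    (h : ∀ u ∈ B, ∀ v ∈ A \ B, ¬ R u v) : (omegaPlus R B).ncard ≤ (omegaPlus R A).ncard :=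
  ncard_le_ncard fun p hp => ⟨hp.1, hBA hp.2.1, fun hpA => h _ hp.2.1 _ ⟨hpA, hp.2.2⟩ hp.1⟩

theorem ncard_omegaMinus_le_of_no_arc {A B : Set V} (hBA : B ⊆ A)
    (h : ∀ u ∈ A \ B, ∀ v ∈ B, ¬ R u v) : (omegaMinus R B).ncard ≤ (omegaMinus R A).ncard :=
  ncard_le_ncard fun p hp => ⟨hp.1, fun hpA => h _ ⟨hpA, hp.2.1⟩ _ hp.2.2 hp.1, hBA hp.2.2⟩

/-- Every bipartition of a `λ`-atom into nonempty parts is crossed by an arc in the given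
direction. -/
theorem IsLambdaAtom.exists_arc {A B : Set V} (hA : IsLambdaAtom R A) (hBA : B ⊆ A)
    (hB : B.Nonempty) (hAB : (A \ B).Nonempty) : ∃ u ∈ B, ∃ v ∈ A \ B, R u v := by
  by_contra! h
  have hproper : ∀ C ⊆ A, C ≠ univ := fun C hC hu => hA.1.ne_univ (univ_subset_iff.1 (hu ▸ hC))
  have hcard := ncard_sdiff_add_ncard_of_subset hBA
  have hBpos := (ncard_pos).2 hB
  have hABpos := (ncard_pos).2 hAB
  rcases hA.1 with hf | hf
  · have := hA.2 B (Or.inl (isPosFragment_of_ncard_le hB (hproper _ hBA)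
      (hf.2.2 ▸ ncard_omegaPlus_le_of_no_arc hBA h)))
    omega
  · have := hA.2 (A \ B) (Or.inr (isNegFragment_of_ncard_le hAB (hproper _ sdiff_subset)
      (hf.2.2 ▸ ncard_omegaMinus_le_of_no_arc sdiff_subset
        (by rwa [sdiff_sdiff_cancel_left hBA]))))
    omega

theorem IsLambdaAtom.exists_forall_adj_mem (hloop : ∀ v, ¬ R v v)
    (hlt : arcConnectivity R < minDegree R) {A : Set V} (hA : IsLambdaAtom R A) :
    (∃ v ∈ A, ∀ w, R v w → w ∈ A) ∨ ∃ v ∈ A, ∀ w, R w v → w ∈ A := by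
  by_contra! h
  refine hlt.not_ge ?_
  rcases hA.1 with hf | hf
  · rw [← hf.2.2]
    refine le_ncard_omegaPlus_of_forall_exists_arc hloop hf.1
      (fun v _ => Nat.sInf_le ⟨v, Or.inl rfl⟩) fun v hv => ?_
    obtain ⟨w, hvw, hw⟩ := h.1 v hv
    exact ⟨w, hw, hvw⟩
  · rw [← hf.2.2]
    refine le_ncard_omegaMinus_of_forall_exists_arc hloop hf.1
      (fun v _ => Nat.sInf_le ⟨v, Or.inr rfl⟩) fun v hv => ?_
    obtain ⟨w, hvw, hw⟩ := h.2 v hv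
    exact ⟨w, hw, hvw⟩

end DigraphCuts

section MixedCayley

variable {G : Type*} [Group G] {S0 S1 T0 T1 : Set G}

theorem not_MDArc_self (hS0 : (1 : G) ∉ S0) (hS1 : (1 : G) ∉ S1) (v : G × Bool) :
    ¬ MDArc S0 S1 T0 T1 v v := by
  rintro (⟨-, -, s, hs, h⟩ | ⟨-, -, s, hs, h⟩ | ⟨h, h', -⟩ | ⟨h, h', -⟩)
  · exact hS0 (right_eq_mul.1 h ▸ hs)
  · exact hS1 (right_eq_mul.1 h ▸ hs)
  all_goals simp_all

theorem MDArc_mul_right_iff (g : G) (u v : G × Bool) :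
    MDArc S0 S1 T0 T1 (u.1 * g, u.2) (v.1 * g, v.2) ↔ MDArc S0 S1 T0 T1 u v := by
  simp [MDArc, ← mul_assoc]

theorem IsLambdaAtom.mul_right_mem_iff [Finite G] {A : Set (G × Bool)}
    (hA : IsLambdaAtom (MDArc S0 S1 T0 T1) A) {g x : G} {i : Bool} (hx : (x, i) ∈ A)
    (hxg : (x * g, i) ∈ A) (y : G) (j : Bool) : (y * g, j) ∈ A ↔ (y, j) ∈ A := by
  let e : G × Bool ≃ G × Bool := (Equiv.mulRight g).prodCongr (Equiv.refl Bool)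
  have h : e '' A = A :=
    hA.image_eq_self e (fun u v => MDArc_mul_right_iff g u v) ⟨_, hxg, (x, i), hx, rfl⟩
  conv_lhs => rw [← h]
  exact e.injective.mem_set_image (a := (y, j))

/-- The elements `g` of the group with `(g, false)` in a given `λ`-atom through `(1, false)`. -/
def lambdaAtomSubgroup [Finite G] {A : Set (G × Bool)}
    (hA : IsLambdaAtom (MDArc S0 S1 T0 T1) A) (h1 : ((1 : G), false) ∈ A) : Subgroup G where
  carrier := {g | (g, false) ∈ A}
  one_mem' := h1
  mul_mem' {a b} ha hb := (hA.mul_right_mem_iff h1 (by simpa using hb) a false).2 ha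
  inv_mem' {a} ha := (hA.mul_right_mem_iff h1 (by simpa using ha) a⁻¹ false).1 (by simpa using h1)

theorem Subgroup.exists_fin_rightCoset_partition [Finite G] (H : Subgroup G) :
    ∃ (k : ℕ) (r : Fin k → G), (univ : Set G) = ⋃ j, (· * r j) '' (H : Set G) ∧
      Pairwise fun j l => Disjoint ((· * r j) '' (H : Set G)) ((· * r l) '' (H : Set G)) := by
  obtain ⟨k, ⟨e⟩⟩ := Finite.exists_equiv_fin (Quotient (QuotientGroup.rightRel H))
  have hmem : ∀ j x, x ∈ (· * (e.symm j).out) '' (H : Set G) ↔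
      (Quotient.mk (QuotientGroup.rightRel H) x) = e.symm j := by
    intro j x
    rw [image_mul_right, mem_preimage, SetLike.mem_coe, ← QuotientGroup.rightRel_apply]
    conv_rhs => rw [← Quotient.out_eq (e.symm j)]
    rw [eq_comm]
    exact Quotient.eq.symm
  refine ⟨k, fun j => (e.symm j).out, ?_, fun j l hjl => ?_⟩
  · refine (eq_univ_of_forall fun x => ?_).symm
    exact mem_iUnion.2 ⟨e (Quotient.mk _ x), (hmem _ _).2 (by simp)⟩
  · refine disjoint_left.2 fun x hj hl => hjl (e.symm.injective ?_)
    rw [← (hmem j x).1 hj, (hmem l x).1 hl]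

end MixedCayley

/-- if a λ-atom `A` contains `(1_G,0)` then `H_1 = t·H_0` for some
`t ∈ T0`, and `G` is a disjoint union of right cosets `H_0·g_j`, with
`X_0 = ⋃_j (H_0 g_j) × {0}` and `X_1 = ⋃_j (t H_0 g_j) × {1}`. -/
theorem mixedCayley_lambdaAtom_coset_structure
    {G : Type*} [Group G] [Fintype G] (S0 S1 T0 T1 : Set G)
    (hS0 : (1 : G) ∉ S0) (hS1 : (1 : G) ∉ S1)
    (hT0 : T0.Nonempty) (hT1 : T1.Nonempty)
    (hsc : DigraphStronglyConnected (MDArc S0 S1 T0 T1))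
    (hlt : arcConnectivity (MDArc S0 S1 T0 T1) < minDegree (MDArc S0 S1 T0 T1))
    (A : Set (G × Bool)) (hA : IsLambdaAtom (MDArc S0 S1 T0 T1) A)
    (h1 : ((1 : G), false) ∈ A) :
    ∃ t ∈ T0,
      {g : G | (g, true) ∈ A} = (t * ·) '' {g : G | (g, false) ∈ A} ∧
      ∃ (k : ℕ) (gj : Fin k → G),
        ((Set.univ : Set G) = ⋃ j, (· * gj j) '' {g : G | (g, false) ∈ A}) ∧
        (Pairwise fun j l =>
          Disjoint ((· * gj j) '' {g : G | (g, false) ∈ A})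
            ((· * gj l) '' {g : G | (g, false) ∈ A})) ∧
        ({p : G × Bool | p.2 = false} =
          ⋃ j, (fun g => (g, false)) '' ((· * gj j) '' {g : G | (g, false) ∈ A})) ∧
        ({p : G × Bool | p.2 = true} =
          ⋃ j, (fun g => (g, true)) ''
            ((· * gj j) '' ((t * ·) '' {g : G | (g, false) ∈ A}))) := by
  have hloop := not_MDArc_self (T0 := T0) (T1 := T1) hS0 hS1
  obtain ⟨u, hu⟩ : ∃ u, (u, true) ∈ A := by
    by_contra! h
    have hfalse : ∀ v ∈ A, v.2 = false := by
      rintro ⟨x, _ | _⟩ hx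
      · rfl
      · exact (h x hx).elim
    rcases hA.exists_forall_adj_mem hloop hlt with ⟨v, hv, hadj⟩ | ⟨v, hv, hadj⟩
    · obtain ⟨t, ht⟩ := hT0
      exact h _ (hadj (t * v.1, true) (Or.inr (Or.inr (Or.inl ⟨hfalse v hv, rfl, t, ht, rfl⟩))))
    · obtain ⟨t, ht⟩ := hT1
      exact h _ (hadj (t * v.1, true) (Or.inr (Or.inr (Or.inr ⟨rfl, hfalse v hv, t, ht, rfl⟩))))
  obtain ⟨t, ht, x, hx, htx⟩ : ∃ t ∈ T0, ∃ x, (x, false) ∈ A ∧ (t * x, true) ∈ A := by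
    obtain ⟨⟨x, i⟩, ⟨hx, hi⟩, ⟨y, j⟩, ⟨hy, hj⟩, hadj⟩ :=
      hA.exists_arc (B := A ∩ {p | p.2 = false}) inter_subset_left ⟨_, h1, rfl⟩
        ⟨(u, true), hu, fun h => Bool.noConfusion h.2⟩
    obtain rfl : i = false := hi
    obtain rfl : j = true := by
      cases j
      · exact (hj ⟨hy, rfl⟩).elim
      · rfl
    rcases hadj with ⟨-, h, -⟩ | ⟨h, -, -⟩ | ⟨-, -, t, ht, rfl⟩ | ⟨h, -, -⟩
    · exact Bool.noConfusion h
    · exact Bool.noConfusion h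
    · exact ⟨t, ht, x, hx, hy⟩
    · exact Bool.noConfusion h
  have ht1 : (t, true) ∈ A :=
    (hA.mul_right_mem_iff h1 (by simpa using hx) t true).1 htx
  have hH1 : {g : G | (g, true) ∈ A} = (t * ·) '' {g : G | (g, false) ∈ A} := by
    ext y
    rw [image_mul_left, mem_preimage, mem_ofPred_eq, mem_ofPred_eq]
    constructor
    · intro hy
      simpa using (hA.mul_right_mem_iff (g := t⁻¹ * y) ht1 (by simpa using hy) 1 false).2 h1
    · intro hy
      simpa using (hA.mul_right_mem_iff (g := t⁻¹ * y) h1 (by simpa using hy) t true).2 ht1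
  obtain ⟨k, r, hcover, hdisj⟩ :=
    (lambdaAtomSubgroup hA h1).exists_fin_rightCoset_partition
  refine ⟨t, ht, hH1, k, r, hcover, hdisj, ?_, ?_⟩
  · rw [← image_iUnion]
    change _ = _ '' ⋃ j, (· * r j) '' (lambdaAtomSubgroup hA h1 : Set G)
    rw [← hcover]
    ext ⟨x, i⟩
    cases i <;> simp
  · have hcomm : ∀ (j : Fin k) (C : Set G),
        (· * r j) '' ((t * ·) '' C) = (t * ·) '' ((· * r j) '' C) := fun j C => by
      simp only [image_image, mul_assoc]
    simp only [hcomm]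
    rw [← image_iUnion, ← image_iUnion]
    change _ = _ '' (_ '' ⋃ j, (· * r j) '' (lambdaAtomSubgroup hA h1 : Set G))
    rw [← hcover, image_univ_of_surjective (mul_left_surjective t)]
    ext ⟨x, i⟩
    cases i <;> simp
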